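/- The dual objective J_α is convex, differentiable on R^n, and has Lipschitz-continuous gradient: for every p ∈ [1, ∞] with Hölder conjugate p* (1/p + 1/p* = 1) and all q₁, q₂ ∈ R^n, ‖∇J_α(q₁) − ∇J_α(q₂)‖_{ℓ^{p*}} ≤ (‖Mᵀ‖²_{p→∞} / α) ‖q₁ − q₂‖_{ℓ^p}, where ‖Mᵀ‖_{p→∞} = sup{ ‖Mᵀx‖_{ℓ^∞} : ‖x‖_{ℓ^p} ≤ 1 } is the operator norm of Mᵀ from ℓ^p to ℓ^∞. -/

import Mathlib

open scoped ENNReal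

/-- The `ℓ^p` norm on `Fin n → ℝ`, for `p ∈ [1, ∞]` (an extended nonnegative real);
`pnorm ⊤ x = sup_i |x i|` and `pnorm p x = (∑ i, |x i|^p)^(1/p)` for finite `p`. -/
noncomputable def pnorm {n : ℕ} (p : ℝ≥0∞) (x : Fin n → ℝ) : ℝ :=
  if p = ⊤ then ⨆ i, |x i| else (∑ i, |x i| ^ p.toReal) ^ (1 / p.toReal)

lemma aux_lse {m : ℕ} (hm : 0 < m) (x y : Fin m → ℝ) (a b : ℝ) (ha : 0 ≤ a) (hb : 0 ≤ b)
    (hab : a + b = 1) :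
    Real.log (∑ k, Real.exp (a * x k + b * y k)) ≤
      a * Real.log (∑ k, Real.exp (x k)) + b * Real.log (∑ k, Real.exp (y k)) := by
  have : Nonempty (Fin m) := ⟨⟨0, hm⟩⟩
  have hpos : ∀ z : Fin m → ℝ, 0 < ∑ k, Real.exp (z k) := fun z =>
    Finset.sum_pos (fun k _ => Real.exp_pos _) Finset.univ_nonempty
  set X := ∑ k, Real.exp (x k) with hX
  set Y := ∑ k, Real.exp (y k) with hY
  have hXp : 0 < X := hpos x
  have hYp : 0 < Y := hpos y
  rw [Real.log_le_iff_le_exp (hpos _)]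
  have key : ∀ k, Real.exp (a * x k + b * y k) ≤
      Real.exp (a * Real.log X + b * Real.log Y) *
        (a * (Real.exp (x k) / X) + b * (Real.exp (y k) / Y)) := by
    intro k
    have h1 := convexOn_exp.2 (Set.mem_univ (x k - Real.log X)) (Set.mem_univ (y k - Real.log Y))
      ha hb hab
    simp only [smul_eq_mul] at h1
    rw [Real.exp_sub, Real.exp_sub, Real.exp_log hXp, Real.exp_log hYp] at h1
    calc Real.exp (a * x k + b * y k) = Real.exp (a * Real.log X + b * Real.log Y) *
          Real.exp (a * (x k - Real.log X) + b * (y k - Real.log Y)) := by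
          rw [← Real.exp_add]; congr 1; ring
      _ ≤ _ := by gcongr
  calc _ ≤ ∑ k, Real.exp (a * Real.log X + b * Real.log Y) *
        (a * (Real.exp (x k) / X) + b * (Real.exp (y k) / Y)) := Finset.sum_le_sum fun k _ => key k
    _ = Real.exp (a * Real.log X + b * Real.log Y) := by
      rw [← Finset.mul_sum, Finset.sum_add_distrib, ← Finset.mul_sum, ← Finset.mul_sum,
        ← Finset.sum_div, ← Finset.sum_div, ← hX, ← hY, div_self hXp.ne', div_self hYp.ne']
      rw [mul_one, mul_one, hab, mul_one]

lemma aux_cov {m : ℕ} (w c u : Fin m → ℝ) (hw : ∀ k, 0 ≤ w k) (h1 : ∑ k, w k = 1)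
    (C D : ℝ) (hC : ∀ k, |c k| ≤ C) (hD : ∀ k, |u k| ≤ D) (hC0 : 0 ≤ C) (hD0 : 0 ≤ D) :
    |∑ k, w k * c k * u k - (∑ k, w k * c k) * (∑ k, w k * u k)| ≤ C * D := by
  have var : ∀ (c : Fin m → ℝ) (C : ℝ), (∀ k, |c k| ≤ C) → 
      ∑ k, w k * (c k - ∑ j, w j * c j) ^ 2 ≤ C ^ 2 := by
    intro c C hC
    set e := ∑ j, w j * c j with he
    have : ∑ k, w k * (c k - e) ^ 2 = ∑ k, w k * c k ^ 2 - e ^ 2 := by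
      have : ∀ k, w k * (c k - e) ^ 2 = w k * c k ^ 2 - 2 * e * (w k * c k) + e ^ 2 * w k := by
        intro k; ring
      simp_rw [this]
      rw [Finset.sum_add_distrib, Finset.sum_sub_distrib, ← Finset.mul_sum, ← Finset.mul_sum, h1,
        ← he]
      ring
    rw [this]
    have h2 : ∑ k, w k * c k ^ 2 ≤ ∑ k, w k * C ^ 2 := by
      refine Finset.sum_le_sum fun k _ => mul_le_mul_of_nonneg_left ?_ (hw k)
      exact sq_le_sq' (by linarith [(abs_le.1 (hC k)).1]) (abs_le.1 (hC k)).2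
    rw [← Finset.sum_mul, h1, one_mul] at h2
    nlinarith [sq_nonneg e]
  set e := ∑ j, w j * c j with he
  set f := ∑ j, w j * u j with hf
  have hcov : ∑ k, w k * c k * u k - e * f =
      ∑ k, (Real.sqrt (w k) * (c k - e)) * (Real.sqrt (w k) * (u k - f)) := by
    have : ∀ k, (Real.sqrt (w k) * (c k - e)) * (Real.sqrt (w k) * (u k - f)) =
        w k * c k * u k - f * (w k * c k) - e * (w k * u k) + e * f * w k := by
      intro k
      have := Real.mul_self_sqrt (hw k)
      linear_combination (c k - e) * (u k - f) * this
    simp_rw [this]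
    rw [Finset.sum_add_distrib, Finset.sum_sub_distrib, Finset.sum_sub_distrib,
      ← Finset.mul_sum, ← Finset.mul_sum, ← Finset.mul_sum, h1, ← he, ← hf]
    ring
  rw [hcov]
  apply abs_le_of_sq_le_sq _ (mul_nonneg hC0 hD0)
  refine (Finset.sum_mul_sq_le_sq_mul_sq _ _ _).trans ?_
  simp_rw [mul_pow, Real.sq_sqrt (hw _)]
  exact mul_le_mul (var c C hC) (var u D hD)
    (Finset.sum_nonneg fun k _ => mul_nonneg (hw k) (sq_nonneg _)) (sq_nonneg _)

lemma aux_softmax {m : ℕ} (hm : 0 < m) (z u c : Fin m → ℝ) (C D : ℝ)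
    (hC : ∀ k, |c k| ≤ C) (hD : ∀ k, |u k| ≤ D) (hC0 : 0 ≤ C) (hD0 : 0 ≤ D) :
    |(∑ k, Real.exp (z k + u k) * c k) / (∑ k, Real.exp (z k + u k)) -
      (∑ k, Real.exp (z k) * c k) / (∑ k, Real.exp (z k))| ≤ C * D := by
  have : Nonempty (Fin m) := ⟨⟨0, hm⟩⟩
  have hpos : ∀ z : Fin m → ℝ, 0 < ∑ k, Real.exp (z k) := fun z =>
    Finset.sum_pos (fun k _ => Real.exp_pos _) Finset.univ_nonempty
  let f : ℝ → ℝ := fun t => (∑ k, Real.exp (z k + t * u k) * c k) / (∑ k, Real.exp (z k + t * u k))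
  have hexp : ∀ t k, HasDerivAt (fun t : ℝ => Real.exp (z k + t * u k))
      (Real.exp (z k + t * u k) * u k) t := by
    intro t k
    have := (((hasDerivAt_id t).mul_const (u k)).const_add (z k)).exp
    simpa using this
  have hder : ∀ t, HasDerivAt f
      (((∑ k, Real.exp (z k + t * u k) * u k * c k) * (∑ k, Real.exp (z k + t * u k)) -
        (∑ k, Real.exp (z k + t * u k) * c k) * (∑ k, Real.exp (z k + t * u k) * u k)) /
        (∑ k, Real.exp (z k + t * u k)) ^ 2) t := by
    intro t
    exact (HasDerivAt.fun_sum fun k _ => (hexp t k).mul_const (c k)).div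
      (HasDerivAt.fun_sum fun k _ => hexp t k) (hpos _).ne'
  have := norm_image_sub_le_of_norm_deriv_le_segment_01' (f := f) (C := C * D)
    (fun t _ => (hder t).hasDerivWithinAt) (by
      intro t _
      have hZ := hpos (fun k => z k + t * u k)
      set Z := ∑ k, Real.exp (z k + t * u k) with hZd
      have h := aux_cov (fun k => Real.exp (z k + t * u k) / Z) c u
        (fun k => by positivity) (by rw [← Finset.sum_div, ← hZd, div_self hZ.ne']) C D hC hD hC0 hD0
      rw [Real.norm_eq_abs]
      convert h using 2
      simp_rw [div_mul_eq_mul_div, ← Finset.sum_div]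
      have : ∑ k, Real.exp (z k + t * u k) * c k * u k = ∑ k, Real.exp (z k + t * u k) * u k * c k :=
        Finset.sum_congr rfl fun k _ => by ring
      rw [this]
      field_simp)
  simpa [f, Real.norm_eq_abs] using this

lemma aux_pnorm {n : ℕ} (hn : 0 < n) (p : ℝ≥0∞) [Fact (1 ≤ p)] (x : Fin n → ℝ) :
    pnorm p x = ‖WithLp.toLp p x‖ := by
  unfold pnorm
  split_ifs with h
  · subst h
    rw [PiLp.norm_eq_ciSup]; simp
  · rw [PiLp.norm_eq_sum]
    · simp
    · exact ENNReal.toReal_pos (by have := Fact.out (p := 1 ≤ p); intro h0; simp [h0] at this) h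

lemma aux_dual {n : ℕ} (hn : 0 < n) (p q : ℝ≥0∞) (hp : 1 ≤ p) (hq : 1 ≤ q)
    (hpq : 1 / p + 1 / q = 1) (g : Fin n → ℝ) :
    ∃ x : Fin n → ℝ, pnorm p x ≤ 1 ∧ pnorm q g = ∑ i, x i * g i := by
  have : Nonempty (Fin n) := ⟨⟨0, hn⟩⟩
  have hs : ∀ r : ℝ, |((SignType.sign r : SignType) : ℝ)| ≤ 1 := by
    intro r
    rcases lt_trichotomy r 0 with h | h | h <;> simp [h]
  by_cases hpt : p = ⊤
  · subst hpt
    have : q = 1 := by simpa using hpq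
    subst this
    refine ⟨fun i => SignType.sign (g i), ?_, ?_⟩
    · simp only [pnorm, if_true]
      exact ciSup_le fun i => hs _
    · simp [pnorm, sign_mul_self]
  by_cases hqt : q = ⊤
  · subst hqt
    have : p = 1 := by simpa using hpq
    subst this
    obtain ⟨i, hi⟩ := exists_eq_ciSup_of_finite (f := fun i => |g i|)
    refine ⟨Pi.single i (SignType.sign (g i) : ℝ), ?_, ?_⟩
    · simp only [pnorm]
      simp [Pi.single_apply, apply_ite]
      exact hs _
    · simp only [pnorm, if_true]
      rw [← hi]
      simp [Pi.single_apply, sign_mul_self]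
  have hc : p.toReal.HolderConjugate q.toReal := by
    have : ENNReal.HolderConjugate p q := by
      rw [ENNReal.holderConjugate_iff]; simpa using hpq
    have h1 : 1 < p := by
      rcases hp.lt_or_eq with h | h
      · exact h
      · subst h
        exfalso
        apply hqt
        simpa using hpq
    rw [Real.holderConjugate_iff]
    refine ⟨?_, ?_⟩
    · have := (ENNReal.toReal_lt_toReal (by simp) hpt).2 h1
      simpa using this
    · have := congrArg ENNReal.toReal hpq
      rw [ENNReal.toReal_add] at this
      · simpa using this
      · simp; rintro rfl; simp at hp
      · simp; rintro rfl; simp at hq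
  obtain ⟨h, hh1, hh2⟩ := (NNReal.isGreatest_Lp Finset.univ (fun i => Real.nnabs (g i)) hc.symm).1
  refine ⟨fun i => h i * SignType.sign (g i), ?_, ?_⟩
  · simp only [pnorm, hpt, if_false]
    apply Real.rpow_le_one (by positivity) _ (by positivity)
    have h3 : ∑ i, h i ^ p.toReal ≤ 1 := hh1
    have h3' : ∑ i, (h i : ℝ) ^ p.toReal ≤ 1 := by exact_mod_cast h3
    refine le_trans (Finset.sum_le_sum fun i _ => ?_) h3'
    refine Real.rpow_le_rpow (abs_nonneg _) ?_ (by positivity)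
    rw [abs_mul, abs_of_nonneg (h i).coe_nonneg]
    exact mul_le_of_le_one_right (h i).coe_nonneg (hs _)
  · simp only [pnorm, hqt, if_false]
    have := congrArg NNReal.toReal hh2
    simp at this
    rw [one_div, ← this]
    refine Finset.sum_congr rfl fun i _ => ?_
    rw [mul_assoc, sign_mul_self, mul_comm]

/-- the dual objective `J_α(q) = ⟨p₀, q⟩ + α log(∑_k exp(−(Mᵀq)_k/α))` is
convex and differentiable on `R^n`, and its gradient is Lipschitz: for Hölder conjugate
exponents `p, p* ∈ [1, ∞]` and all `q₁, q₂`,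
`‖∇J_α(q₁) − ∇J_α(q₂)‖_{ℓ^{p*}} ≤ (‖Mᵀ‖²_{p→∞}/α) ‖q₁ − q₂‖_{ℓ^p}`, where
`‖Mᵀ‖_{p→∞} = sup{‖Mᵀx‖_{ℓ^∞} : ‖x‖_{ℓ^p} ≤ 1}`. -/
theorem stmt9 (n m : ℕ) (hn : 0 < n) (hm : 0 < m)
    (M : Matrix (Fin n) (Fin m) ℝ) (p₀ : Fin n → ℝ) (α : ℝ) (hα : 0 < α) :
    let J : (Fin n → ℝ) → ℝ := fun q =>
      (∑ i, p₀ i * q i) + α * Real.log (∑ k, Real.exp (-(M.transpose.mulVec q k) / α))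
    let gradJ : (Fin n → ℝ) → (Fin n → ℝ) := fun q i => fderiv ℝ J q (Pi.single i 1)
    ConvexOn ℝ Set.univ J ∧ Differentiable ℝ J ∧
      ∀ p pstar : ℝ≥0∞, 1 ≤ p → 1 ≤ pstar → 1 / p + 1 / pstar = 1 →
        ∀ q₁ q₂ : Fin n → ℝ,
          pnorm pstar (gradJ q₁ - gradJ q₂) ≤
            (sSup {y : ℝ | ∃ x : Fin n → ℝ, pnorm p x ≤ 1 ∧
                y = pnorm ⊤ (M.transpose.mulVec x)}) ^ 2 / α * pnorm p (q₁ - q₂) := by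
  intro J gradJ
  have : Nonempty (Fin m) := ⟨⟨0, hm⟩⟩
  have hpos : ∀ z : Fin m → ℝ, 0 < ∑ k, Real.exp (z k) := fun z =>
    Finset.sum_pos (fun k _ => Real.exp_pos _) Finset.univ_nonempty
  let L : Fin m → ((Fin n → ℝ) →L[ℝ] ℝ) := fun k =>
    LinearMap.toContinuousLinearMap ((LinearMap.proj k).comp M.transpose.mulVecLin)
  let P : (Fin n → ℝ) →L[ℝ] ℝ := ∑ i, p₀ i • ContinuousLinearMap.proj (R := ℝ) (φ := fun _ : Fin n => ℝ) i
  have hL : ∀ k q, L k q = M.transpose.mulVec q k := fun k q => rfl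
  have hP : ∀ q, P q = ∑ i, p₀ i * q i := fun q => by simp [P]
  have hJ : J = fun q => P q + α * Real.log (∑ k, Real.exp ((-α⁻¹) * L k q)) := by
    funext q
    simp only [J, hP, hL]
    congr! 5
    field_simp
  have hder : ∀ q, HasFDerivAt J (P + α • ((∑ k, Real.exp ((-α⁻¹) * L k q))⁻¹ •
      ∑ k, Real.exp ((-α⁻¹) * L k q) • ((-α⁻¹) • L k))) q := by
    intro q
    rw [hJ]
    refine P.hasFDerivAt.add (HasFDerivAt.const_mul ?_ α)
    refine HasFDerivAt.log (HasFDerivAt.fun_sum fun k _ => ?_) (hpos _).ne'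
    exact ((L k).hasFDerivAt.const_mul _).exp
  have hfd : ∀ q v, fderiv ℝ J q v = P v - (∑ k, Real.exp ((-α⁻¹) * L k q) * L k v) /
      (∑ k, Real.exp ((-α⁻¹) * L k q)) := by
    intro q v
    rw [(hder q).fderiv]
    simp [mul_left_comm _ α⁻¹, ← Finset.mul_sum]
    field_simp
    try ring
  refine ⟨⟨convex_univ, ?_⟩, fun q => (hder q).differentiableAt, ?_⟩
  · intro x _ y _ a b ha hb hab
    rw [hJ]
    simp only [map_add, map_smul, smul_eq_mul]
    have h := aux_lse hm (fun k => (-α⁻¹) * L k x) (fun k => (-α⁻¹) * L k y) a b ha hb hab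
    have e : ∀ k, (-α⁻¹) * (a * L k x + b * L k y) = a * ((-α⁻¹) * L k x) + b * ((-α⁻¹) * L k y) :=
      fun k => by ring
    simp_rw [e]
    have := mul_le_mul_of_nonneg_left h hα.le
    linarith
  intro p r hp hr hpr q₁ q₂
  have : Fact (1 ≤ p) := ⟨hp⟩
  set S := {y : ℝ | ∃ x : Fin n → ℝ, pnorm p x ≤ 1 ∧ y = pnorm ⊤ (M.transpose.mulVec x)} with hS
  have htop : ∀ (z : Fin m → ℝ) k, |z k| ≤ pnorm ⊤ z := by
    intro z k
    simp only [pnorm, if_true]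
    exact le_ciSup (f := fun k => |z k|) (Set.finite_range _).bddAbove k
  have hbdd : BddAbove S := by
    refine ⟨∑ k, ∑ i, |M i k|, ?_⟩
    rintro y ⟨x, hx, rfl⟩
    simp only [pnorm, if_true]
    refine ciSup_le fun k => ?_
    refine le_trans ?_ (Finset.single_le_sum (f := fun k => ∑ i, |M i k|)
      (fun k _ => Finset.sum_nonneg fun i _ => abs_nonneg _) (Finset.mem_univ k))
    have hmv : M.transpose.mulVec x k = ∑ i, M i k * x i := rfl
    rw [hmv]
    refine (Finset.abs_sum_le_sum_abs (fun i => M i k * x i) _).trans (Finset.sum_le_sum fun i _ => ?_)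
    rw [abs_mul]
    refine mul_le_of_le_one_right (abs_nonneg _) ?_
    rw [aux_pnorm hn] at hx
    exact (PiLp.norm_apply_le (WithLp.toLp p x) i).trans hx
  set K := sSup S with hK
  have hK1 : ∀ x, pnorm p x ≤ 1 → ∀ k, |L k x| ≤ K := fun x hx k =>
    (htop _ k).trans (le_csSup hbdd ⟨x, hx, rfl⟩)
  have hK0 : 0 ≤ K := by
    have := hK1 0 (by rw [aux_pnorm hn]; simp) ⟨0, hm⟩
    exact (abs_nonneg _).trans this
  have hpn : ∀ x : Fin n → ℝ, 0 ≤ pnorm p x := fun x => by rw [aux_pnorm hn]; exact norm_nonneg _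
  have hK2 : ∀ x k, |L k x| ≤ K * pnorm p x := by
    intro x k
    rcases (hpn x).eq_or_lt with h | h
    · have : x = 0 := by
        rw [aux_pnorm hn] at h
        simpa using h.symm
      subst this
      rw [← h]; simp
    · have := hK1 ((pnorm p x)⁻¹ • x) (by
        rw [aux_pnorm hn, WithLp.toLp_smul, norm_smul, ← aux_pnorm hn, Real.norm_eq_abs,
          abs_of_pos (inv_pos.2 h), inv_mul_cancel₀ h.ne']) k
      rw [map_smul, smul_eq_mul, abs_mul, abs_of_pos (inv_pos.2 h), inv_mul_le_iff₀ h] at this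
      linarith
  obtain ⟨x, hx, hxe⟩ := aux_dual hn p r hp hr hpr (gradJ q₁ - gradJ q₂)
  rw [hxe]
  have hlin : ∀ q, ∑ i, x i * gradJ q i = fderiv ℝ J q x := by
    intro q
    have := LinearMap.pi_apply_eq_sum_univ (fderiv ℝ J q).toLinearMap x
    simp only [ContinuousLinearMap.coe_coe, smul_eq_mul] at this
    rw [this]
    refine Finset.sum_congr rfl fun i _ => ?_
    simp only [gradJ]
    congr 2
    funext j
    simp [Pi.single_apply, eq_comm]
  simp only [Pi.sub_apply, mul_sub, Finset.sum_sub_distrib]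
  rw [hlin, hlin, hfd, hfd]
  have h := aux_softmax hm (fun k => (-α⁻¹) * L k q₁) (fun k => α⁻¹ * L k (q₁ - q₂))
    (fun k => L k x) K (α⁻¹ * (K * pnorm p (q₁ - q₂))) (hK1 x hx) (by
      intro k
      rw [abs_mul, abs_of_pos (inv_pos.2 hα)]
      have := hK2 (q₁ - q₂) k
      gcongr) hK0 (by have := hpn (q₁ - q₂); positivity)
  have e : ∀ k, (-α⁻¹) * L k q₁ + α⁻¹ * L k (q₁ - q₂) = (-α⁻¹) * L k q₂ := by
    intro k; rw [map_sub]; ring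
  simp only [e] at h
  have h2 := (abs_le.1 h).2
  have e2 : K ^ 2 / α * pnorm p (q₁ - q₂) = K * (α⁻¹ * (K * pnorm p (q₁ - q₂))) := by
    field_simp
  rw [e2]
  linarith
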